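/- (Milnor–Wolf) A finitely generated solvable group G has exponential growth unless G contains a nilpotent subgroup of finite index. That is, if G is a finitely generated solvable group with no nilpotent subgroup of finite index, then for some (equivalently, any) finite symmetric generating set S there exists c > 1 with γ_S(n) ≥ c^n for all n ≥ 1. -/

import Mathlib

open scoped BigOperators

/-- The ball of radius `n` in a group `G` with respect to a set `S`:
elements expressible as a product of at most `n` elements of `S`. -/
def ball {G : Type*} [Group G] (S : Set G) (n : ℕ) : Set G :=
  {g | ∃ l : List G, (∀ x ∈ l, x ∈ S) ∧ l.length ≤ n ∧ l.prod = g}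

/-- The growth function of `G` relative to `S`: `γ_S(n) = |B_S(n)|`. -/
noncomputable def growth {G : Type*} [Group G] (S : Set G) (n : ℕ) : ℕ := (ball S n).ncard

/-- A finite symmetric generating set of `G`. -/
def IsSymmGen {G : Type*} [Group G] (S : Finset G) : Prop :=
  (∀ x ∈ S, x⁻¹ ∈ S) ∧ Subgroup.closure (S : Set G) = ⊤

/-- `G` has polynomial growth: for some finite symmetric generating set `S`
there are `C > 0` and `k : ℕ` with `γ_S(n) ≤ C * n ^ k` for all `n ≥ 1`. -/
def HasPolyGrowth (G : Type*) [Group G] : Prop :=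
  ∃ S : Finset G, IsSymmGen S ∧ ∃ C : ℝ, 0 < C ∧ ∃ k : ℕ,
    ∀ n : ℕ, 1 ≤ n → (growth (S : Set G) n : ℝ) ≤ C * (n : ℝ) ^ k

open Polynomial
/-- The roots of a nonzero polynomial with coefficients in `{-1, 0, 1}` have modulus at most `2`. -/
lemma norm_le_two_of_isRoot {p : ℤ[X]} (hp : p ≠ 0) (hc : ∀ n, |p.coeff n| ≤ 1) {z : ℂ}
    (hz : aeval z p = 0) : ‖z‖ ≤ 2 := by
  have hinj : Function.Injective (Int.castRingHom ℂ) := (Int.castRingHom ℂ).injective_int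
  have hp' : p.map (Int.castRingHom ℂ) ≠ 0 := (Polynomial.map_ne_zero_iff hinj).2 hp
  have hroot : (p.map (Int.castRingHom ℂ)).IsRoot z := by
    rw [IsRoot.def, eval_map]
    simpa [aeval_def] using hz
  have hlt := hroot.norm_lt_cauchyBound hp'
  have hnorm : ∀ n : ℤ, ‖(n : ℂ)‖₊ = ‖n‖₊ := fun n => by
    apply NNReal.eq; simp [Int.norm_eq_abs]
  have hle : cauchyBound (p.map (Int.castRingHom ℂ)) ≤ 2 := by
    have hlead : ‖(p.map (Int.castRingHom ℂ)).leadingCoeff‖₊ = 1 := by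
      rw [leadingCoeff_map_of_injective hinj]
      have h1 := hc p.natDegree
      have h2 : p.leadingCoeff ≠ 0 := leadingCoeff_ne_zero.2 hp
      have h3 : |p.leadingCoeff| = 1 := le_antisymm h1 (Int.one_le_abs h2)
      rw [eq_intCast, hnorm]
      apply NNReal.eq
      rw [coe_nnnorm, Int.norm_eq_abs, ← Int.cast_abs, h3]
      simp
    rw [cauchyBound, hlead, div_one]
    have : (Finset.range (p.map (Int.castRingHom ℂ)).natDegree).sup
        (fun n => ‖(p.map (Int.castRingHom ℂ)).coeff n‖₊) ≤ 1 := by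
      apply Finset.sup_le
      intro n _
      rw [coeff_map, eq_intCast, hnorm, ← NNReal.coe_le_coe, coe_nnnorm, Int.norm_eq_abs]
      rw [← Int.cast_abs, NNReal.coe_one]
      exact_mod_cast hc n
    calc _ ≤ (1 : NNReal) + 1 := by gcongr
      _ = 2 := by norm_num
  have := hlt.le.trans hle
  exact_mod_cast this

lemma norm_le_one_of_forall_pow {z : ℂ} (h : ∀ j : ℕ, 0 < j → ‖z ^ j‖ ≤ 2) : ‖z‖ ≤ 1 := by
  by_contra! hz
  obtain ⟨n, hn⟩ := pow_unbounded_of_one_lt 2 hz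
  have := h n (by rcases n with _ | n <;> [norm_num at hn; omega])
  rw [norm_pow] at this
  linarith

/-- **Kronecker's theorem**: a nonzero algebraic integer all of whose conjugates lie in the
closed unit disc is a root of unity. -/
lemma pow_eq_one_of_conjugates_norm_le_one {z : ℂ} (hz0 : z ≠ 0) (hz : IsIntegral ℤ z)
    (h : ∀ w : ℂ, aeval w (minpoly ℤ z) = 0 → ‖w‖ ≤ 1) : ∃ n, 0 < n ∧ z ^ n = 1 := by
  let K := IntermediateField.adjoin ℚ {z}
  let : NumberField K := {
    to_charZero := (IntermediateField.adjoin ℚ {z}).charZero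
    to_finiteDimensional := IntermediateField.adjoin.finiteDimensional hz.tower_top }
  let y : K := ⟨z, IntermediateField.mem_adjoin_simple_self ℚ z⟩
  have hy : IsIntegral ℤ y := by
    rw [← isIntegral_algebraMap_iff (B := ℂ) (algebraMap K ℂ).injective]
    exact hz
  obtain ⟨n, hn, hy1⟩ := NumberField.Embeddings.pow_eq_one_of_norm_le_one (x := y) K ℂ
    (Subtype.coe_ne_coe.mp hz0) hy (fun φ => by
      apply h
      have h1 : aeval z (minpoly ℤ z) = 0 := minpoly.aeval _ _
      have h2 : aeval y (minpoly ℤ z) = 0 := by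
        apply (algebraMap K ℂ).injective
        rw [map_zero, ← aeval_algebraMap_apply]
        exact h1
      have h3 := congrArg φ h2
      rw [map_zero] at h3
      rw [← h3]
      exact (aeval_algHom_apply φ.toIntAlgHom y (minpoly ℤ z)))
  refine ⟨n, hn, ?_⟩
  have := congrArg (algebraMap K ℂ) hy1
  rwa [map_pow, map_one] at this

/-- A prime ideal `P` of `ℤ[X]` contains some `X ^ k - 1` with `k > 0` as soon as, for every `j > 0`,
it contains a polynomial in `X ^ j` with coefficients in `{-1, 0, 1}` and constant coefficient `1`. -/
lemma exists_X_pow_sub_one_mem_of_isPrime (P : Ideal ℤ[X]) [P.IsPrime]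
    (h : ∀ j : ℕ, 0 < j → ∃ p : ℤ[X], p.coeff 0 = 1 ∧ (∀ n, |p.coeff n| ≤ 1) ∧
      p.comp (X ^ j) ∈ P) : ∃ k : ℕ, 0 < k ∧ (X ^ k - 1 : ℤ[X]) ∈ P := by
  have hne : ∀ p : ℤ[X], p.coeff 0 = 1 → p ≠ 0 := by rintro p hp rfl; simp at hp
  obtain ⟨p, hp0, hpc, hpP⟩ := h 1 one_pos
  rw [pow_one, comp_X] at hpP
  let R := ℤ[X] ⧸ P
  let μ : R := Ideal.Quotient.mk P X
  have hmk : ∀ q : ℤ[X], aeval μ q = Ideal.Quotient.mk P q := fun q => by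
    have := aeval_algHom_apply (Ideal.Quotient.mkₐ ℤ P) X q
    rw [aeval_X_left_apply] at this
    exact this
  have hX : μ ≠ 0 := by
    intro hX
    have hXP : X ∈ P := Ideal.Quotient.eq_zero_iff_mem.1 hX
    have h1 : (X * p.divX + C (p.coeff 0)) ∈ P := by rwa [X_mul_divX_add]
    have h2 := (Ideal.add_mem_iff_right P (P.mul_mem_right _ hXP)).1 h1
    rw [hp0, C_1] at h2
    exact (Ideal.ne_top_iff_one P).1 (Ideal.IsPrime.ne_top inferInstance) h2
  have hint : IsIntegral ℤ μ := by
    have h2 : p.leadingCoeff ≠ 0 := leadingCoeff_ne_zero.2 (hne p hp0)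
    have h3 : |p.leadingCoeff| = 1 := le_antisymm (hpc _) (Int.one_le_abs h2)
    have hp1 : aeval μ p = 0 := by rw [hmk]; exact Ideal.Quotient.eq_zero_iff_mem.2 hpP
    rcases (abs_eq zero_le_one).1 h3 with h4 | h4
    · exact ⟨p, h4, hp1⟩
    · refine ⟨-p, ?_, ?_⟩
      · rw [Monic, leadingCoeff_neg, h4, neg_neg]
      · rw [← aeval_def, map_neg, hp1, neg_zero]
  have hsurj : Function.Surjective (Ideal.Quotient.mk P) := Ideal.Quotient.mk_surjective
  suffices ∃ k : ℕ, 0 < k ∧ μ ^ k = 1 by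
    obtain ⟨k, hk, h1⟩ := this
    refine ⟨k, hk, Ideal.Quotient.eq_zero_iff_mem.1 ?_⟩
    rw [map_sub, map_pow, map_one, sub_eq_zero]
    exact h1
  by_cases hinj : Function.Injective (algebraMap ℤ R)
  · have : Module.IsTorsionFree ℤ R := by
      have : CharZero R := ⟨fun a b hab => by
        have := @hinj a b (by simpa using hab)
        exact_mod_cast this⟩
      infer_instance
    obtain ⟨z, hz⟩ : ∃ z : ℂ, aeval z (minpoly ℤ μ) = 0 := by
      apply IsAlgClosed.exists_aeval_eq_zero_of_injective _ (Int.castRingHom ℂ).injective_int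
      exact (minpoly.degree_pos hint).ne'
    have hirr := minpoly.irreducible hint
    have hzi : IsIntegral ℤ z := ⟨minpoly ℤ μ, minpoly.monic hint, hz⟩
    have hassoc : Associated (minpoly ℤ z) (minpoly ℤ μ) :=
      (minpoly.irreducible hzi).associated_of_dvd hirr (minpoly.isIntegrallyClosed_dvd hzi hz)
    have hmin : ∀ q : ℤ[X], aeval z q = 0 ↔ q ∈ P := fun q => by
      rw [minpoly.isIntegrallyClosed_dvd_iff hzi, hassoc.dvd_iff_dvd_left,
        ← minpoly.isIntegrallyClosed_dvd_iff hint, hmk, Ideal.Quotient.eq_zero_iff_mem]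
    obtain ⟨k, hk, h1⟩ := pow_eq_one_of_conjugates_norm_le_one (z := z) (by
        rintro rfl
        apply hX
        exact Ideal.Quotient.eq_zero_iff_mem.2 ((hmin X).1 (by simp))) hzi (by
      intro w hw
      apply norm_le_one_of_forall_pow
      intro j hj
      obtain ⟨q, hq0, hqc, hqP⟩ := h j hj
      refine norm_le_two_of_isRoot (hne q hq0) hqc ?_
      obtain ⟨r, hr⟩ := minpoly.isIntegrallyClosed_dvd hzi ((hmin _).2 hqP)
      have := congrArg (aeval w) hr
      rw [map_mul, hw, zero_mul, aeval_comp] at this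
      simpa using this)
    refine ⟨k, hk, ?_⟩
    have := (hmin (X ^ k - 1)).1 (by simp [h1])
    have := Ideal.Quotient.eq_zero_iff_mem.2 this
    rw [map_sub, map_pow, map_one, sub_eq_zero] at this
    exact this
  · have hfin : Finite R := by
      have : Module.Finite ℤ R := by
        have htop : Algebra.adjoin ℤ {μ} = ⊤ := by
          rw [eq_top_iff]
          rintro r -
          obtain ⟨q, rfl⟩ := hsurj r
          rw [← hmk]
          exact aeval_mem_adjoin_singleton ℤ μ
        have := hint.fg_adjoin_singleton
        rw [htop] at this
        exact Module.finite_def.2 this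
      obtain ⟨n, hn, hn0⟩ : ∃ n : ℤ, algebraMap ℤ R n = 0 ∧ n ≠ 0 := by
        rw [injective_iff_map_eq_zero] at hinj
        push Not at hinj
        exact hinj
      apply Module.finite_of_fg_torsion R
      intro r
      refine ⟨⟨n, mem_nonZeroDivisors_of_ne_zero hn0⟩, ?_⟩
      change n • r = 0
      have hn' : (n : R) = 0 := by simpa using hn
      rw [zsmul_eq_mul, hn', zero_mul]
    obtain ⟨a, b, hab, h1⟩ := Finite.exists_ne_map_eq_of_infinite (fun n : ℕ => μ ^ n)
    wlog hlt : a < b generalizing a b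
    · exact this b a hab.symm h1.symm (by omega)
    refine ⟨b - a, by omega, ?_⟩
    have h2 : μ ^ a * μ ^ (b - a) = μ ^ a * 1 := by
      rw [← pow_add, mul_one, Nat.add_sub_cancel' hlt.le]
      exact h1.symm
    exact mul_left_cancel₀ (pow_ne_zero _ hX) h2

lemma exists_pow_sub_one_pow_eq_zero {M : Type*} [AddCommGroup M] [Module.Finite ℤ M]
    (φ : Module.End ℤ M)
    (h : ∀ x : M, ∀ j : ℕ, 0 < j → ∃ p : ℤ[X], p.coeff 0 = 1 ∧ (∀ n, |p.coeff n| ≤ 1) ∧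
      aeval (φ ^ j) p x = 0) : ∃ k : ℕ, 0 < k ∧ ∃ m : ℕ, (φ ^ k - 1) ^ m = 0 := by
  let J : M → Ideal ℤ[X] := fun x =>
    { carrier := {p | aeval φ p x = 0}
      add_mem' := fun {p q} hp hq => by
        simp only [Set.mem_ofPred_eq, map_add, LinearMap.add_apply] at *
        rw [hp, hq, add_zero]
      zero_mem' := by simp
      smul_mem' := fun c p hp => by
        simp only [Set.mem_ofPred_eq, smul_eq_mul, map_mul, Module.End.mul_apply] at *
        rw [hp, map_zero] }
  have hJ : ∀ x p, p ∈ J x ↔ aeval φ p x = 0 := fun _ _ => Iff.rfl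
  obtain ⟨s, hs⟩ := (Module.finite_def (R := ℤ) (M := M)).1 inferInstance
  let I : Ideal ℤ[X] := s.inf J
  have hI : ∀ p ∈ I, aeval φ p = 0 := by
    intro p hp
    apply LinearMap.ext_on hs
    intro x hx
    exact (Finset.inf_le (f := J) hx) hp
  have hprime : ∀ P ∈ I.minimalPrimes, ∃ k : ℕ, 0 < k ∧ (X ^ k - 1 : ℤ[X]) ∈ P := by
    intro P hP
    have : P.IsPrime := hP.1.1
    obtain ⟨x, -, hx⟩ := (Ideal.IsPrime.inf_le' inferInstance).1 hP.1.2
    apply exists_X_pow_sub_one_mem_of_isPrime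
    intro j hj
    obtain ⟨p, h0, hc, hp⟩ := h x j hj
    refine ⟨p, h0, hc, hx ?_⟩
    rw [hJ, aeval_comp]
    simpa using hp
  have hfin := I.finite_minimalPrimes_of_isNoetherianRing
  choose! k hk hkP using hprime
  let K := ∏ P ∈ hfin.toFinset, k P
  have hK : 0 < K := Finset.prod_pos (fun P hP => hk P (by simpa using hP))
  have hrad : (X ^ K - 1 : ℤ[X]) ∈ I.radical := by
    rw [← Ideal.sInf_minimalPrimes, Submodule.mem_sInf]
    intro P hP
    obtain ⟨c, hc⟩ : k P ∣ K := Finset.dvd_prod_of_mem _ (by simpa using hP)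
    rw [hc, pow_mul]
    refine Ideal.mem_of_dvd P ?_ (hkP P hP)
    simpa using sub_dvd_pow_sub_pow (X ^ k P : ℤ[X]) 1 c
  obtain ⟨m, hm⟩ := hrad
  refine ⟨K, hK, m, ?_⟩
  simpa using hI _ hm

/-- The word obtained from `l` by reading `true` as `x * y` and `false` as `y`. -/
def binWord {G : Type*} [Group G] (x y : G) (l : List Bool) : G :=
  (l.map fun b => if b then x * y else y).prod

/-- No pair `x * y, y` freely generates a free submonoid, even among words of equal length. -/
def HasCollisions (G : Type*) [Group G] : Prop :=
  ∀ x y : G, ∃ l l' : List Bool, l.length = l'.length ∧ l ≠ l' ∧ binWord x y l = binWord x y l'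

section
variable {G H : Type*} [Group G] [Group H]

@[simp] lemma binWord_nil (x y : G) : binWord x y [] = 1 := rfl

lemma binWord_cons (x y : G) (b : Bool) (l : List Bool) :
    binWord x y (b :: l) = (if b then x * y else y) * binWord x y l := rfl

lemma map_binWord (f : G →* H) (x y : G) (l : List Bool) :
    f (binWord x y l) = binWord (f x) (f y) l := by
  induction l with
  | nil => simp
  | cons b l ih => cases b <;> simp [binWord_cons, ih]

lemma HasCollisions.of_injective (hG : HasCollisions G) (f : H →* G)
    (hf : Function.Injective f) : HasCollisions H := fun x y => by
  obtain ⟨l, l', h1, h2, h3⟩ := hG (f x) (f y)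
  exact ⟨l, l', h1, h2, hf (by rw [map_binWord, map_binWord, h3])⟩

lemma HasCollisions.of_surjective (hG : HasCollisions G) (f : G →* H)
    (hf : Function.Surjective f) : HasCollisions H := fun x y => by
  obtain ⟨x, rfl⟩ := hf x
  obtain ⟨y, rfl⟩ := hf y
  obtain ⟨l, l', h1, h2, h3⟩ := hG x y
  exact ⟨l, l', h1, h2, by rw [← map_binWord, ← map_binWord, h3]⟩

lemma HasCollisions.exists_relation (hG : HasCollisions G) (x y : G) :
    ∃ u v : List Bool, u.length = v.length ∧ x * y * binWord x y u = y * binWord x y v := by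
  obtain ⟨l, l', h1, h2, h3⟩ := hG x y
  induction l generalizing l' with
  | nil => exact absurd (List.length_eq_zero_iff.1 h1.symm).symm h2
  | cons b l ih =>
    cases l' with
    | nil => simp at h1
    | cons b' l' =>
      rw [List.length_cons, List.length_cons, Nat.add_right_cancel_iff] at h1
      rw [binWord_cons, binWord_cons] at h3
      cases b <;> cases b' <;> simp only [if_true, Bool.false_eq_true, if_false] at h3
      · exact ih l' h1 (by simpa using h2) (mul_left_cancel h3)
      · exact ⟨l', l, h1.symm, h3.symm⟩
      · exact ⟨l, l', h1, h3⟩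
      · exact ih l' h1 (by simpa using h2) (mul_left_cancel h3)

lemma binWord_mem_closure (x y : G) (l : List Bool) :
    ∃ g ∈ Subgroup.closure ((fun i : ℤ => y ^ i * x * y ^ (-i)) '' Set.Ico 0 (l.length : ℤ)),
      binWord x y l = g * y ^ l.length := by
  induction l with
  | nil => exact ⟨1, one_mem _, by simp⟩
  | cons b l ih =>
    obtain ⟨g, hg, h⟩ := ih
    set c := fun i : ℤ => y ^ i * x * y ^ (-i) with hc
    have hy : y * g * y⁻¹ ∈ Subgroup.closure (c '' Set.Ico 0 ((b :: l).length : ℤ)) := by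
      have : (MulAut.conj y) g ∈ (Subgroup.closure (c '' Set.Ico 0 (l.length : ℤ))).map
          (MulAut.conj y).toMonoidHom := Subgroup.mem_map_of_mem _ hg
      rw [MonoidHom.map_closure] at this
      refine Subgroup.closure_mono ?_ this
      rintro _ ⟨_, ⟨i, hi, rfl⟩, rfl⟩
      refine ⟨i + 1, ?_, ?_⟩
      · simp only [Set.mem_Ico, List.length_cons] at hi ⊢
        push_cast
        omega
      · simp only [hc, MulEquiv.toMonoidHom_eq_coe, MonoidHom.coe_coe, MulAut.conj_apply]
        group
    have hx : x ∈ Subgroup.closure (c '' Set.Ico 0 ((b :: l).length : ℤ)) := by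
      apply Subgroup.subset_closure
      refine ⟨0, ⟨le_rfl, ?_⟩, by simp [hc]⟩
      rw [List.length_cons]
      positivity
    cases b
    · refine ⟨_, hy, ?_⟩
      rw [binWord_cons, h, List.length_cons, pow_succ']
      simp [mul_assoc]
    · refine ⟨_, mul_mem hx hy, ?_⟩
      rw [binWord_cons, h, List.length_cons, pow_succ']
      simp [mul_assoc]

lemma HasCollisions.exists_mem_closure (hG : HasCollisions G) (x y : G) :
    ∃ m : ℕ, x ∈ Subgroup.closure ((fun i : ℤ => y ^ i * x * y ^ (-i)) '' Set.Icc 1 (m : ℤ)) := by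
  obtain ⟨u, v, huv, h⟩ := hG.exists_relation x y
  obtain ⟨a, ha, hu⟩ := binWord_mem_closure x y u
  obtain ⟨b, hb, hv⟩ := binWord_mem_closure x y v
  rw [← huv] at hb hv
  refine ⟨u.length, ?_⟩
  have hx : x = MulAut.conj y (b * a⁻¹) := by
    rw [hu, hv, ← mul_assoc, ← mul_assoc, mul_left_inj] at h
    rw [MulAut.conj_apply, ← mul_assoc, ← h]
    group
  have : (MulAut.conj y) (b * a⁻¹) ∈ Subgroup.map (MulAut.conj y).toMonoidHom _ :=
    Subgroup.mem_map_of_mem _ (mul_mem hb (inv_mem ha))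
  rw [← hx, MonoidHom.map_closure] at this
  refine Subgroup.closure_mono ?_ this
  rintro _ ⟨_, ⟨i, hi, rfl⟩, rfl⟩
  refine ⟨i + 1, ?_, ?_⟩
  · simp only [Set.mem_Ico, Set.mem_Icc] at hi ⊢
    omega
  · simp only [MulEquiv.toMonoidHom_eq_coe, MonoidHom.coe_coe, MulAut.conj_apply]
    group

/-- **Milnor's lemma**: in a group with collisions, the conjugates of `x` by the powers of `y`
generate a finitely generated subgroup. -/
lemma HasCollisions.exists_finset_closure_eq (hG : HasCollisions G) (x y : G) :
    ∃ s : Finset G, Subgroup.closure (s : Set G) =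
      Subgroup.closure (Set.range fun i : ℤ => y ^ i * x * y ^ (-i)) := by
  classical
  set c := fun i : ℤ => y ^ i * x * y ^ (-i) with hc
  obtain ⟨m₁, h₁⟩ := hG.exists_mem_closure x y
  obtain ⟨m₂, h₂⟩ := hG.exists_mem_closure x y⁻¹
  let m := max m₁ m₂
  have hconj : ∀ (k : ℤ) (s : Set ℤ), x ∈ Subgroup.closure (c '' s) →
      c k ∈ Subgroup.closure (c '' ((k + ·) '' s)) := by
    intro k s hs
    have : (MulAut.conj (y ^ k)) x ∈ Subgroup.map (MulAut.conj (y ^ k)).toMonoidHom _ :=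
      Subgroup.mem_map_of_mem _ hs
    rw [MonoidHom.map_closure] at this
    have h2 : c k = MulAut.conj (y ^ k) x := by
      simp only [hc, MulAut.conj_apply, zpow_neg]
    rw [h2]
    refine Subgroup.closure_mono ?_ this
    rintro _ ⟨_, ⟨i, hi, rfl⟩, rfl⟩
    refine ⟨k + i, ⟨i, hi, rfl⟩, ?_⟩
    simp only [hc, MulEquiv.toMonoidHom_eq_coe, MonoidHom.coe_coe, MulAut.conj_apply]
    group
  have hup : ∀ k, c k ∈ Subgroup.closure (c '' Set.Icc (k + 1) (k + m)) := by
    intro k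
    refine Subgroup.closure_mono (Set.image_mono ?_) (hconj k _ h₁)
    rintro _ ⟨i, hi, rfl⟩
    simp only [Set.mem_Icc] at hi ⊢
    omega
  have hdown : ∀ k, c k ∈ Subgroup.closure (c '' Set.Icc (k - m) (k - 1)) := by
    intro k
    have h₂' : x ∈ Subgroup.closure (c '' Set.Icc (-m₂ : ℤ) (-1)) := by
      refine Subgroup.closure_mono ?_ h₂
      rintro _ ⟨i, hi, rfl⟩
      refine ⟨-i, ?_, by simp [hc]⟩
      simp only [Set.mem_Icc] at hi ⊢
      omega
    refine Subgroup.closure_mono (Set.image_mono ?_) (hconj k _ h₂')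
    rintro _ ⟨i, hi, rfl⟩
    simp only [Set.mem_Icc] at hi ⊢
    omega
  let F := Subgroup.closure (c '' Set.Icc 0 (m : ℤ))
  have hpos : ∀ n : ℕ, c n ∈ F := by
    intro n
    induction n using Nat.strong_induction_on with
    | _ n ih =>
      by_cases hn : n ≤ m
      · exact Subgroup.subset_closure ⟨n, by simp; omega, rfl⟩
      · refine (Subgroup.closure_le F).2 ?_ (hdown n)
        rintro _ ⟨i, hi, rfl⟩
        simp only [Set.mem_Icc] at hi
        obtain ⟨j, rfl⟩ := Int.eq_ofNat_of_zero_le (show 0 ≤ i by omega)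
        exact ih j (by omega)
  have hneg : ∀ n : ℕ, c (-n) ∈ F := by
    intro n
    induction n using Nat.strong_induction_on with
    | _ n ih =>
      refine (Subgroup.closure_le F).2 ?_ (hup (-n))
      rintro _ ⟨i, hi, rfl⟩
      simp only [Set.mem_Icc] at hi
      by_cases hi0 : 0 ≤ i
      · obtain ⟨j, rfl⟩ := Int.eq_ofNat_of_zero_le hi0
        exact hpos j
      · obtain ⟨j, hj⟩ := Int.eq_ofNat_of_zero_le (show 0 ≤ -i by omega)
        obtain rfl : i = -j := by omega
        exact ih j (by omega)
  refine ⟨(Finset.Icc 0 (m : ℤ)).image c, ?_⟩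
  rw [Finset.coe_image, Finset.coe_Icc]
  apply le_antisymm
  · exact Subgroup.closure_mono (Set.image_subset_range _ _)
  · rw [Subgroup.closure_le]
    rintro _ ⟨i, rfl⟩
    obtain ⟨n, rfl | rfl⟩ := i.eq_nat_or_neg
    · exact hpos n
    · exact hneg n
end

section
variable {G : Type*} [Group G]

lemma fg_of_normal_sup_zpowers (hG : HasCollisions G) [hfg : Group.FG G] (N : Subgroup G)
    [N.Normal] (a : G) (hN : N ⊔ Subgroup.zpowers a = ⊤) : N.FG := by
  have hdec : ∀ g : G, ∃ n ∈ N, ∃ k : ℤ, n * a ^ k = g := by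
    intro g
    have : g ∈ N ⊔ Subgroup.zpowers a := hN ▸ Subgroup.mem_top g
    obtain ⟨n, hn, _, ⟨k, rfl⟩, h⟩ := Subgroup.mem_sup_of_normal_left.1 this
    exact ⟨n, hn, k, h⟩
  choose n hn k hk using hdec
  obtain ⟨S, hS⟩ := hfg.out
  choose F hF using fun x => hG.exists_finset_closure_eq x a
  let U : Subgroup G := ⨆ s ∈ S, Subgroup.closure (Set.range fun i : ℤ => a ^ i * n s * a ^ (-i))
  have hUfg : U.FG := Subgroup.FG.biSup_finset S _ fun s _ => ⟨F (n s), hF _⟩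
  have hUN : U ≤ N := by
    refine iSup₂_le fun s _ => (Subgroup.closure_le N).2 ?_
    rintro _ ⟨i, rfl⟩
    simpa using (inferInstance : N.Normal).conj_mem _ (hn s) (a ^ i)
  have hconj : ∀ j : ℤ, U ≤ U.comap (MulAut.conj (a ^ j)).toMonoidHom := by
    intro j
    refine iSup₂_le fun s hs => (Subgroup.closure_le _).2 ?_
    rintro _ ⟨i, rfl⟩
    have h1 : Subgroup.closure (Set.range fun i : ℤ => a ^ i * n s * a ^ (-i)) ≤ U :=
      le_iSup₂_of_le s hs le_rfl
    refine h1 (Subgroup.subset_closure ⟨j + i, ?_⟩)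
    simp only [MulEquiv.toMonoidHom_eq_coe, MonoidHom.coe_coe, MulAut.conj_apply]
    group
  have hanorm : a ∈ Subgroup.normalizer (U : Set G) := by
    rw [Subgroup.mem_normalizer_iff]
    intro h
    constructor
    · intro hh
      simpa using hconj 1 hh
    · intro hh
      have := hconj (-1) hh
      simpa [mul_assoc] using this
  have hsup : U ⊔ Subgroup.zpowers a = ⊤ := by
    rw [eq_top_iff, ← hS, Subgroup.closure_le]
    intro s hs
    rw [← hk s]
    refine mul_mem (Subgroup.mem_sup_left ?_) (Subgroup.mem_sup_right ⟨k s, rfl⟩)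
    have h1 : Subgroup.closure (Set.range fun i : ℤ => a ^ i * n s * a ^ (-i)) ≤ U :=
      le_iSup₂_of_le s hs le_rfl
    exact h1 (Subgroup.subset_closure ⟨0, by simp⟩)
  have hUnormal : U.Normal := by
    rw [← Subgroup.normalizer_eq_top_iff, eq_top_iff, ← hsup, sup_le_iff]
    exact ⟨Subgroup.le_normalizer, by rwa [Subgroup.zpowers_le]⟩
  have hcyc : (N ⊓ Subgroup.zpowers a).FG := by
    obtain ⟨g, hg⟩ := (Subgroup.isCyclic_iff_exists_zpowers_eq_top (N ⊓ Subgroup.zpowers a)).1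
      (Subgroup.isCyclic_of_le inf_le_right)
    rw [← hg]
    exact ⟨{g}, by simp [Subgroup.zpowers_eq_closure]⟩
  have : N = U ⊔ (N ⊓ Subgroup.zpowers a) := by
    apply le_antisymm _ (sup_le hUN inf_le_left)
    intro g hg
    have : g ∈ U ⊔ Subgroup.zpowers a := hsup ▸ Subgroup.mem_top g
    obtain ⟨u, hu, z, hz, rfl⟩ := Subgroup.mem_sup_of_normal_left.1 this
    refine mul_mem (Subgroup.mem_sup_left hu) (Subgroup.mem_sup_right ⟨?_, hz⟩)
    exact (N.mul_mem_cancel_left (hUN hu)).1 hg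
  rw [this]
  exact hUfg.sup hcyc

lemma forall_subgroup_fg_of_normal_sup_zpowers (N : Subgroup G) [N.Normal] (a : G)
    (hN : N ⊔ Subgroup.zpowers a = ⊤) (h : ∀ L ≤ N, L.FG) (L : Subgroup G) : L.FG := by
  have hcyc : IsCyclic (G ⧸ N) := by
    refine ⟨QuotientGroup.mk' N a, fun q => ?_⟩
    obtain ⟨g, rfl⟩ := QuotientGroup.mk'_surjective N q
    have : g ∈ N ⊔ Subgroup.zpowers a := hN ▸ Subgroup.mem_top g
    obtain ⟨n, hn, _, ⟨k, rfl⟩, rfl⟩ := Subgroup.mem_sup_of_normal_left.1 this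
    refine ⟨k, ?_⟩
    have : QuotientGroup.mk' N n = 1 := (QuotientGroup.eq_one_iff n).2 hn
    simp only [map_mul, this, one_mul, map_zpow]
  obtain ⟨q, hq⟩ := (Subgroup.isCyclic_iff_exists_zpowers_eq_top
    (L.map (QuotientGroup.mk' N))).1 inferInstance
  have hqm : q ∈ L.map (QuotientGroup.mk' N) := hq ▸ Subgroup.mem_zpowers q
  obtain ⟨l, hl, rfl⟩ := hqm
  have : L = (L ⊓ N) ⊔ Subgroup.zpowers l := by
    apply le_antisymm
    · intro g hg
      have hgm : QuotientGroup.mk' N g ∈ L.map (QuotientGroup.mk' N) :=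
        Subgroup.mem_map_of_mem _ hg
      rw [← hq] at hgm
      obtain ⟨k, hk⟩ := hgm
      have h1 : g * (l ^ k)⁻¹ ∈ N := by
        rw [← QuotientGroup.eq_one_iff, ← QuotientGroup.mk'_apply, map_mul, map_inv, map_zpow,
          ← hk]
        exact mul_inv_cancel _
      have h2 : g = g * (l ^ k)⁻¹ * l ^ k := by simp
      rw [h2]
      exact mul_mem (Subgroup.mem_sup_left ⟨L.mul_mem hg (L.inv_mem (L.zpow_mem hl k)), h1⟩)
        (Subgroup.mem_sup_right ⟨k, rfl⟩)
    · exact sup_le inf_le_left (by rwa [Subgroup.zpowers_le])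
  rw [this]
  refine (h _ inf_le_right).sup ⟨{l}, by simp [Subgroup.zpowers_eq_closure]⟩

end

/-- The polynomial whose coefficients are the given bits. -/
noncomputable def bitPoly : List Bool → ℤ[X]
  | [] => 0
  | b :: l => C (if b then 1 else 0) + X * bitPoly l

lemma coeff_bitPoly (l : List Bool) (n : ℕ) :
    (bitPoly l).coeff n = 0 ∨ (bitPoly l).coeff n = 1 := by
  induction l generalizing n with
  | nil => simp [bitPoly]
  | cons b l ih =>
    cases n with
    | zero => cases b <;> simp [bitPoly]
    | succ n => cases b <;> simpa [bitPoly, coeff_one] using ih n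

/-- The iterated commutator `⁅⋯⁅⁅A, H⁆, H⁆⋯, H⁆`. -/
def iterComm {G : Type*} [Group G] (A H : Subgroup G) : ℕ → Subgroup G
  | 0 => A
  | n + 1 => ⁅iterComm A H n, H⁆

section
variable {G : Type*} [Group G]

lemma map_iterComm {Q : Type*} [Group Q] (f : G →* Q) (A H : Subgroup G) (n : ℕ) :
    (iterComm A H n).map f = iterComm (A.map f) (H.map f) n := by
  induction n with
  | zero => rfl
  | succ n ih => rw [iterComm, iterComm, Subgroup.map_commutator, ih]

lemma iterComm_mono {A B : Subgroup G} (h : A ≤ B) (H : Subgroup G) (n : ℕ) :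
    iterComm A H n ≤ iterComm B H n := by
  induction n with
  | zero => exact h
  | succ n ih => exact Subgroup.commutator_mono ih le_rfl

lemma iterComm_lowerCentralSeries (H : Subgroup G) (m n : ℕ) :
    iterComm (H.lowerCentralSeries m) H n = H.lowerCentralSeries (m + n) := by
  induction n with
  | zero => rfl
  | succ n ih => rw [iterComm, ih, ← add_assoc, Subgroup.lowerCentralSeries_succ]

lemma commutator_sup_zpowers_le {C D N : Subgroup G} {b : G} (hDC : D ≤ C)
    (hN : ∀ z ∈ C, ∀ n ∈ N, n * z = z * n) (hb : ∀ z ∈ C, b * z * b⁻¹ * z⁻¹ ∈ D)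
    (hb' : ∀ z ∈ C, b⁻¹ * z * b ∈ C) : ⁅C, N ⊔ Subgroup.zpowers b⁆ ≤ D := by
  have key : ∀ h ∈ N ⊔ Subgroup.zpowers b, ∀ z ∈ C,
      h * z * h⁻¹ ∈ C ∧ h⁻¹ * z * h ∈ C ∧ h * z * h⁻¹ * z⁻¹ ∈ D := by
    intro h hh
    rw [Subgroup.zpowers_eq_closure, ← Subgroup.closure_eq N, ← Subgroup.closure_union] at hh
    induction hh using Subgroup.closure_induction with
    | mem h hh =>
      intro z hz
      rcases hh with hh | rfl
      · have h1 := hN z hz h hh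
        have h2 : h * z * h⁻¹ = z := by rw [h1]; group
        have h3 : h⁻¹ * z * h = z := by rw [mul_assoc, ← h1]; group
        rw [h2, h3, mul_inv_cancel]
        exact ⟨hz, hz, one_mem _⟩
      · refine ⟨?_, hb' z hz, hb z hz⟩
        have := C.mul_mem (hDC (hb z hz)) hz
        simpa using this
    | one => intro z hz; refine ⟨by simpa using hz, by simpa using hz, by simp⟩
    | mul h g _ _ ih ig =>
      intro z hz
      obtain ⟨a1, a2, a3⟩ := ig z hz
      obtain ⟨b1, b2, b3⟩ := ih _ a1
      refine ⟨by simpa [mul_assoc] using b1, ?_, ?_⟩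
      · simpa [mul_assoc] using (ig _ (ih z hz).2.1).2.1
      · simpa [mul_assoc] using D.mul_mem b3 a3
    | inv h _ ih =>
      intro z hz
      obtain ⟨a1, a2, a3⟩ := ih z hz
      refine ⟨by simpa using a2, by simpa using a1, ?_⟩
      have := D.inv_mem (ih _ a2).2.2
      simpa [mul_assoc] using this
  rw [Subgroup.commutator_le]
  intro z hz h hh
  have := D.inv_mem (key h hh z hz).2.2
  rw [commutatorElement_def]
  simpa [mul_assoc] using this

lemma Subgroup.FG.map_hom {Q : Type*} [Group Q] {H : Subgroup G} (hH : H.FG)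
    (f : G →* Q) : (H.map f).FG := by
  classical
  obtain ⟨S, rfl⟩ := hH
  exact ⟨S.image f, by rw [Finset.coe_image, MonoidHom.map_closure]⟩

lemma exists_iterComm_eq_bot (hG : HasCollisions G) (A N : Subgroup G) [hAn : A.Normal]
    (hA : A.FG) (hAN : A ≤ N) (hcomm : ∀ z ∈ A, ∀ n ∈ N, n * z = z * n) (a : G) :
    ∃ k : ℕ, 0 < k ∧ ∃ m, ∀ K, k ∣ K → iterComm A (N ⊔ Subgroup.zpowers (a ^ K)) m = ⊥ := by
  let _ : CommGroup A := { (inferInstance : Group A) with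
    mul_comm := fun x y => Subtype.ext (hcomm y y.2 x (hAN x.2)) }
  let φ : Module.End ℤ (Additive A) :=
    (MonoidHom.toAdditive (MulAut.conjNormal a : A ≃* A).toMonoidHom).toIntLinearMap
  have hφ : ∀ z : Additive A, ((φ z).toMul : G) = a * z.toMul * a⁻¹ := fun z => rfl
  have hφpow : ∀ (j : ℕ) (z : Additive A),
      (((φ ^ j) z).toMul : G) = a ^ j * z.toMul * (a ^ j)⁻¹ := by
    intro j z
    induction j with
    | zero => simp
    | succ j ih =>
      rw [pow_succ', Module.End.mul_apply, hφ, ih, pow_succ']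
      group
  have hfin : Module.Finite ℤ (Additive A) := by
    have : Group.FG A := (Group.fg_iff_subgroup_fg A).2 hA
    exact Module.Finite.iff_addGroup_fg.2 inferInstance
  obtain ⟨k, hk, m, hm⟩ := exists_pow_sub_one_pow_eq_zero φ (by
    intro x j _
    have hword : ∀ l : List Bool, binWord (x.toMul : G) (a ^ j) l =
        ((aeval (φ ^ j) (bitPoly l) x).toMul : G) * (a ^ j) ^ l.length := by
      intro l
      induction l with
      | nil => simp [bitPoly]
      | cons b l ih =>
        rw [binWord_cons, ih, bitPoly, map_add, map_mul, aeval_X, LinearMap.add_apply,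
          Module.End.mul_apply, toMul_add, Subgroup.coe_mul, hφpow, List.length_cons, pow_succ']
        cases b <;> simp [mul_assoc]
    obtain ⟨u, v, huv, h⟩ := hG.exists_relation (x.toMul : G) (a ^ j)
    refine ⟨1 + X * (bitPoly u - bitPoly v), by simp, ?_, ?_⟩
    · rintro (_ | n)
      · simp
      · rw [coeff_add, coeff_X_mul, coeff_sub, coeff_one]
        rcases coeff_bitPoly u n with h1 | h1 <;> rcases coeff_bitPoly v n with h2 | h2 <;>
          simp [h1, h2]
    · have h1 : ((x + (φ ^ j) (aeval (φ ^ j) (bitPoly u) x)).toMul : G) =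
          (((φ ^ j) (aeval (φ ^ j) (bitPoly v) x)).toMul : G) := by
        rw [toMul_add, Subgroup.coe_mul, hφpow, hφpow]
        rw [hword, hword, huv, ← mul_assoc, ← mul_assoc, mul_left_inj] at h
        rw [← h]
        group
      have h2 : x + (φ ^ j) (aeval (φ ^ j) (bitPoly u) x) =
          (φ ^ j) (aeval (φ ^ j) (bitPoly v) x) := Additive.toMul.injective (Subtype.ext h1)
      rw [map_add, map_mul, aeval_X, map_sub, map_one, LinearMap.add_apply,
        Module.End.mul_apply, LinearMap.sub_apply, map_sub, ← h2, Module.End.one_apply]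
      abel)
  refine ⟨k, hk, m, ?_⟩
  rintro K hK
  let E : Module.End ℤ (Additive A) := φ ^ K - 1
  have hE : E ^ m = 0 := by
    obtain ⟨c, rfl⟩ := hK
    have hcomm : Commute (φ ^ k - 1) (∑ i ∈ Finset.range c, (φ ^ k) ^ i) := by
      apply Commute.sum_right
      intro i _
      exact ((Commute.refl _).sub_left (Commute.one_left _)).pow_right i
    have : E = (φ ^ k - 1) * ∑ i ∈ Finset.range c, (φ ^ k) ^ i := by
      rw [mul_geom_sum, ← pow_mul]
    rw [this, hcomm.mul_pow, hm, zero_mul]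
  let Z : ℕ → Subgroup G := fun n =>
    (AddSubgroup.toSubgroup' (LinearMap.ker (E ^ n)).toAddSubgroup).map A.subtype
  have hZ : ∀ n (z : Additive A), (E ^ n) z = 0 → (z.toMul : G) ∈ Z n := fun n z hz =>
    ⟨z.toMul, hz, rfl⟩
  have hZ' : ∀ n g, g ∈ Z n → ∃ z : Additive A, (E ^ n) z = 0 ∧ (z.toMul : G) = g := by
    rintro n _ ⟨z, hz, rfl⟩
    exact ⟨Additive.ofMul z, hz, rfl⟩
  have hEz : ∀ z : Additive A, ((E z).toMul : G) =
      a ^ K * z.toMul * (a ^ K)⁻¹ * (z.toMul : G)⁻¹ := by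
    intro z
    rw [← hφpow, ← div_eq_mul_inv]
    rw [show E z = (φ ^ K) z - z from rfl, toMul_sub]
    exact A.coe_div _ _
  have hstep : ∀ n, ⁅Z (n + 1), N ⊔ Subgroup.zpowers (a ^ K)⁆ ≤ Z n := by
    intro n
    apply commutator_sup_zpowers_le
    · intro g hg
      obtain ⟨z, hz, rfl⟩ := hZ' _ _ hg
      apply hZ
      rw [pow_succ', Module.End.mul_apply, hz, map_zero]
    · intro g hg
      obtain ⟨z, hz, rfl⟩ := hZ' _ _ hg
      exact hcomm _ z.toMul.2
    · intro g hg
      obtain ⟨z, hz, rfl⟩ := hZ' _ _ hg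
      rw [← hEz]
      apply hZ
      rwa [pow_succ, Module.End.mul_apply] at hz
    · intro g hg
      obtain ⟨z, hz, rfl⟩ := hZ' _ _ hg
      let w : Additive A := Additive.ofMul ⟨(a ^ K)⁻¹ * z.toMul * a ^ K, by
        simpa using hAn.conj_mem _ z.toMul.2 (a ^ K)⁻¹⟩
      have hw : (φ ^ K) w = z := by
        apply Additive.toMul.injective
        apply Subtype.ext
        rw [hφpow]
        simp [w, mul_assoc]
      have hinj : Function.Injective (φ ^ K) := by
        intro p q hpq
        have h1 := congrArg (fun z : Additive A => (z.toMul : G)) hpq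
        simp only [hφpow] at h1
        exact Additive.toMul.injective (Subtype.ext (mul_left_cancel (mul_right_cancel h1)))
      refine hZ _ w (hinj ?_)
      have hc : Commute (φ ^ K) (E ^ (n + 1)) :=
        ((Commute.refl _).sub_right (Commute.one_right _)).pow_right _
      rw [← Module.End.mul_apply, hc.eq, Module.End.mul_apply, hw, hz, map_zero]
  have hchain : ∀ n ≤ m, iterComm A (N ⊔ Subgroup.zpowers (a ^ K)) n ≤ Z (m - n) := by
    intro n hn
    induction n with
    | zero =>
      intro g hg
      refine hZ _ (Additive.ofMul ⟨g, hg⟩) ?_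
      rw [Nat.sub_zero, hE, LinearMap.zero_apply]
    | succ n ih =>
      refine (Subgroup.commutator_mono (ih (by omega)) le_rfl).trans ?_
      rw [show m - n = m - (n + 1) + 1 by omega]
      exact hstep _
  rw [eq_bot_iff]
  intro g hg
  have := hchain m le_rfl hg
  rw [Nat.sub_self] at this
  obtain ⟨z, hz, rfl⟩ := hZ' _ _ this
  rw [pow_zero, Module.End.one_apply] at hz
  rw [hz]
  exact Subgroup.mem_bot.2 rfl

open scoped commutatorElement in
lemma exists_isNilpotent_sup_zpowers (hG : HasCollisions G) (N : Subgroup G) [N.Normal]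
    (hN : Group.IsNilpotent N) (hfg : ∀ L ≤ N, L.FG) (a : G) :
    ∃ k : ℕ, 0 < k ∧ Group.IsNilpotent (N ⊔ Subgroup.zpowers (a ^ k) : Subgroup G) := by
  obtain ⟨c, hc⟩ := (Subgroup.isNilpotent_iff_lowerCentralSeries N).1 hN
  have hsec : ∀ i, ∃ k : ℕ, 0 < k ∧ ∃ m, ∀ K, k ∣ K →
      iterComm (N.lowerCentralSeries i) (N ⊔ Subgroup.zpowers (a ^ K)) m ≤
        N.lowerCentralSeries (i + 1) := by
    intro i
    let f := QuotientGroup.mk' (N.lowerCentralSeries (i + 1))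
    have hf : Function.Surjective f := QuotientGroup.mk'_surjective _
    have hnorm : ((N.lowerCentralSeries i).map f).Normal :=
      (inferInstance : (N.lowerCentralSeries i).Normal).map f hf
    obtain ⟨k, hk, m, hm⟩ := exists_iterComm_eq_bot (hG.of_surjective f hf)
      ((N.lowerCentralSeries i).map f) (N.map f)
      (Subgroup.FG.map_hom (hfg _ (N.lowerCentralSeries_le_self i)) f)
      (Subgroup.map_mono (N.lowerCentralSeries_le_self i)) (by
        rintro _ ⟨z, hz, rfl⟩ _ ⟨n, hn, rfl⟩
        have h1 : ⁅z, n⁆ ∈ N.lowerCentralSeries (i + 1) :=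
          Subgroup.commutator_mem_commutator hz hn
        have h2 : f ⁅z, n⁆ = 1 := (QuotientGroup.eq_one_iff _).2 h1
        rw [map_commutatorElement, commutatorElement_eq_one_iff_mul_comm] at h2
        exact h2.symm) (f a)
    refine ⟨k, hk, m, fun K hK => ?_⟩
    have h1 := hm K hK
    rw [← map_pow, ← MonoidHom.map_zpowers, ← Subgroup.map_sup, ← map_iterComm,
      Subgroup.map_eq_bot_iff, QuotientGroup.ker_mk'] at h1
    exact h1
  choose k hk m hm using hsec
  refine ⟨∏ i ∈ Finset.range c, k i, Finset.prod_pos fun i _ => hk i, ?_⟩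
  set K := ∏ i ∈ Finset.range c, k i
  set H := N ⊔ Subgroup.zpowers (a ^ K)
  have hle : ∀ i ≤ c, ∃ n, H.lowerCentralSeries n ≤ N.lowerCentralSeries i := by
    intro i hi
    induction i with
    | zero =>
      refine ⟨1, ?_⟩
      rw [Subgroup.lowerCentralSeries_succ, Subgroup.lowerCentralSeries_zero,
        Subgroup.lowerCentralSeries_zero, Subgroup.commutator_le]
      intro g hg h hh
      obtain ⟨n₁, hn₁, _, ⟨i, rfl⟩, rfl⟩ := Subgroup.mem_sup_of_normal_left.1 hg
      obtain ⟨n₂, hn₂, _, ⟨j, rfl⟩, rfl⟩ := Subgroup.mem_sup_of_normal_left.1 hh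
      rw [← QuotientGroup.eq_one_iff, ← QuotientGroup.mk'_apply, map_commutatorElement,
        commutatorElement_eq_one_iff_mul_comm, map_mul, map_mul,
        show QuotientGroup.mk' N n₁ = 1 from (QuotientGroup.eq_one_iff _).2 hn₁,
        show QuotientGroup.mk' N n₂ = 1 from (QuotientGroup.eq_one_iff _).2 hn₂,
        one_mul, one_mul, ← map_mul, ← map_mul]
      congr 1
      exact (Commute.refl _).zpow_zpow i j
    | succ i ih =>
      obtain ⟨n, hn⟩ := ih (by omega)
      refine ⟨n + m i, ?_⟩
      rw [← iterComm_lowerCentralSeries]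
      exact (iterComm_mono hn H _).trans
        (hm i K (Finset.dvd_prod_of_mem _ (Finset.mem_range.2 (by omega))))
  obtain ⟨n, hn⟩ := hle c le_rfl
  rw [hc, le_bot_iff] at hn
  exact (Subgroup.isNilpotent_iff_lowerCentralSeries H).2 ⟨n, hn⟩
end

lemma exists_characteristic_le {N : Type*} [Group N] [Group.FG N] (L : Subgroup N)
    [L.FiniteIndex] : ∃ F : Subgroup N, F.Characteristic ∧ F.FiniteIndex ∧ F ≤ L := by
  have hfin : Finite (N →* Equiv.Perm (N ⧸ L)) := by
    obtain ⟨S, hS⟩ := Group.fg_def.1 (inferInstance : Group.FG N)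
    refine Finite.of_injective (fun f (s : S) => f s) fun f g hfg => ?_
    refine MonoidHom.eq_of_eqOn_dense hS fun s hs => ?_
    exact congrFun hfg ⟨s, hs⟩
  refine ⟨⨅ f : N →* Equiv.Perm (N ⧸ L), f.ker, ?_, ?_, ?_⟩
  · rw [Subgroup.characteristic_iff_le_comap]
    intro φ x hx
    rw [Subgroup.mem_comap, Subgroup.mem_iInf]
    rw [Subgroup.mem_iInf] at hx
    exact fun f => hx (f.comp φ.toMonoidHom)
  · exact Subgroup.finiteIndex_iInf fun f => Subgroup.finiteIndex_ker f
  · refine (iInf_le _ (MulAction.toPermHom N (N ⧸ L))).trans ?_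
    rw [← Subgroup.normalCore_eq_ker]
    exact L.normalCore_le

lemma isVirtuallyNilpotent_of_normal_sup_zpowers {G : Type*} [Group G] (hG : HasCollisions G)
    (N : Subgroup G) [N.Normal] (a : G) (hN : N ⊔ Subgroup.zpowers a = ⊤)
    (h : ∀ L ≤ N, L.FG) (hv : Group.IsVirtuallyNilpotent N) :
    Group.IsVirtuallyNilpotent G := by
  obtain ⟨L, hL, hLfin⟩ := hv
  have : Group.FG N := (Group.fg_iff_subgroup_fg N).2 (h N le_rfl)
  obtain ⟨F, hFchar, hFfin, hFL⟩ := exists_characteristic_le L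
  have hFnil : Group.IsNilpotent (F.map N.subtype) := by
    have h1 : Group.IsNilpotent F :=
      (Group.isNilpotent_congr (Subgroup.subgroupOfEquivOfLe hFL)).1 inferInstance
    exact (Group.isNilpotent_congr (F.equivMapOfInjective _ N.subtype_injective)).1 h1
  have hFle : F.map N.subtype ≤ N := Subgroup.map_subtype_le F
  obtain ⟨k, hk, hnil⟩ := exists_isNilpotent_sup_zpowers hG (F.map N.subtype) hFnil
    (fun M hM => h M (hM.trans hFle)) a
  refine ⟨_, hnil, ?_⟩
  set H := F.map N.subtype ⊔ Subgroup.zpowers (a ^ k)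
  have hsurj : Function.Surjective fun p : (N ⧸ F) × Fin k =>
      ((p.1.out * a ^ (p.2 : ℕ) : G) : G ⧸ H) := by
    intro q
    induction q using QuotientGroup.induction_on with
    | H g =>
    have hg : g ∈ N ⊔ Subgroup.zpowers a := hN ▸ Subgroup.mem_top g
    obtain ⟨n, hn, _, ⟨i, rfl⟩, rfl⟩ := Subgroup.mem_sup_of_normal_left.1 hg
    have hk' : (k : ℤ) ≠ 0 := by omega
    have h0 := Int.emod_nonneg i hk'
    have h1 := Int.emod_lt_of_pos i (by omega : (0 : ℤ) < k)
    refine ⟨((⟨n, hn⟩ : N), ⟨(i % k).toNat, by omega⟩), ?_⟩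
    obtain ⟨f, hf⟩ := QuotientGroup.mk_out_eq_mul F ⟨n, hn⟩
    set r := (i % k).toNat
    have hi : i = r + k * (i / k) := by
      rw [Int.toNat_of_nonneg h0, Int.emod_add_mul_ediv]
    have hmem : (a ^ r)⁻¹ * (f : N) * a ^ r ∈ F.map N.subtype := by
      have : (F.map N.subtype).Normal := inferInstance
      simpa using this.conj_mem _ (Subgroup.mem_map_of_mem N.subtype f.2) (a ^ r)⁻¹
    simp only [hf]
    rw [QuotientGroup.eq]
    have : (((⟨n, hn⟩ : N) * f : N) * a ^ r : G)⁻¹ * (n * a ^ i) =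
        ((a ^ r)⁻¹ * (f : N) * a ^ r)⁻¹ * (a ^ k) ^ (i / k) := by
      conv_lhs => rw [hi, zpow_add, zpow_mul, zpow_natCast, zpow_natCast]
      simp [mul_assoc]
    rw [this]
    exact H.mul_mem (H.inv_mem ((le_sup_left : _ ≤ H) hmem))
      ((le_sup_right : _ ≤ H) ⟨_, rfl⟩)
  have : Finite (G ⧸ H) := Finite.of_surjective _ hsurj
  exact Subgroup.finiteIndex_of_finite_quotient

lemma Subgroup.FG.of_map_injective {G H : Type*} [Group G] [Group H] {f : G →* H}
    (hf : Function.Injective f) {L : Subgroup G} (h : (L.map f).FG) : L.FG := by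
  have h1 : Group.FG (L.map f) := (Group.fg_iff_subgroup_fg _).2 h
  have h2 : Group.FG L :=
    Group.fg_of_surjective (f := (L.equivMapOfInjective f hf).symm.toMonoidHom)
      (L.equivMapOfInjective f hf).symm.surjective
  exact (Group.fg_iff_subgroup_fg _).1 h2

lemma Group.IsVirtuallyNilpotent.of_equiv {G H : Type*} [Group G] [Group H]
    (h : Group.IsVirtuallyNilpotent G) (e : G ≃* H) : Group.IsVirtuallyNilpotent H := by
  obtain ⟨L, hL, hfin⟩ := h
  refine ⟨L.map e.toMonoidHom, (Group.isNilpotent_congr (e.subgroupMap L)).1 hL, ⟨?_⟩⟩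
  have := Subgroup.index_map_equiv L e
  exact this ▸ hfin.index_ne_zero

/-- A subgroup that is virtually nilpotent and all of whose subgroups are finitely generated. -/
def IsVirtuallyNilpotentMax {G : Type*} [Group G] (K : Subgroup G) : Prop :=
  (∀ L ≤ K, L.FG) ∧ Group.IsVirtuallyNilpotent K

section
variable {G : Type*} [Group G]

lemma cyclic_extension (hG : HasCollisions G) {K H : Subgroup G} (hKH : K ≤ H)
    (hn : (K.subgroupOf H).Normal) {a : G} (hsup : K ⊔ Subgroup.zpowers a = H) :
    (H.FG → K.FG) ∧ (IsVirtuallyNilpotentMax K → IsVirtuallyNilpotentMax H) := by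
  have ha : a ∈ H := hsup ▸ (le_sup_right : _ ≤ K ⊔ _) (Subgroup.mem_zpowers a)
  have hGH : HasCollisions H := hG.of_injective H.subtype H.subtype_injective
  have hmap : (K.subgroupOf H).map H.subtype = K := by
    rw [Subgroup.map_subgroupOf_eq_of_le hKH]
  have htop : K.subgroupOf H ⊔ Subgroup.zpowers (⟨a, ha⟩ : H) = ⊤ := by
    apply Subgroup.map_injective H.subtype_injective
    rw [Subgroup.map_sup, hmap, MonoidHom.map_zpowers, ← MonoidHom.range_eq_map,
      Subgroup.range_subtype]
    exact hsup
  constructor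
  · intro hH
    have : Group.FG H := (Group.fg_iff_subgroup_fg H).2 hH
    rw [← hmap]
    exact (fg_of_normal_sup_zpowers hGH _ _ htop).map_hom _
  · rintro ⟨h1, h2⟩
    have h1' : ∀ L ≤ K.subgroupOf H, L.FG := fun L hL =>
      Subgroup.FG.of_map_injective H.subtype_injective (h1 _ (hmap ▸ Subgroup.map_mono hL))
    refine ⟨fun L hL => ?_, ?_⟩
    · rw [← Subgroup.map_subgroupOf_eq_of_le hL]
      exact (forall_subgroup_fg_of_normal_sup_zpowers _ _ htop h1' _).map_hom _
    · exact isVirtuallyNilpotent_of_normal_sup_zpowers hGH _ _ htop h1'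
        (h2.of_equiv (Subgroup.subgroupOfEquivOfLe hKH).symm)

lemma abelian_extension (hG : HasCollisions G) (H : Subgroup G) (s : Finset G)
    (K : Subgroup G) (hK : ⁅H, H⁆ ≤ K) (hs : K ⊔ Subgroup.closure (s : Set G) = H) :
    (H.FG → K.FG) ∧ (IsVirtuallyNilpotentMax K → IsVirtuallyNilpotentMax H) := by
  classical
  induction s using Finset.induction_on generalizing K with
  | empty =>
    obtain rfl : K = H := by simpa using hs
    exact ⟨id, id⟩
  | insert a s _ ih =>
    rw [Finset.coe_insert, Set.insert_eq, Subgroup.closure_union,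
      ← Subgroup.zpowers_eq_closure, ← sup_assoc] at hs
    have hle : K ⊔ Subgroup.zpowers a ≤ H := hs ▸ le_sup_left
    obtain ⟨h1, h2⟩ := ih (K ⊔ Subgroup.zpowers a) (hK.trans le_sup_left) hs
    obtain ⟨h3, h4⟩ := cyclic_extension hG (K := K) le_sup_left (by
      refine ⟨fun k hk g => ?_⟩
      rw [Subgroup.mem_subgroupOf] at hk ⊢
      have h := K.mul_mem (hK (Subgroup.commutator_mem_commutator (hle g.2) (hle k.2))) hk
      simpa [commutatorElement_def] using h) (a := a) rfl
    exact ⟨h3 ∘ h1, h2 ∘ h4⟩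

theorem isVirtuallyNilpotent_of_hasCollisions (hG : HasCollisions G) (hfg : Group.FG G)
    (hsolv : Group.IsSolvable G) : Group.IsVirtuallyNilpotent G := by
  have hstep : ∀ i, (derivedSeries G i).FG → (derivedSeries G (i + 1)).FG ∧
      (IsVirtuallyNilpotentMax (derivedSeries G (i + 1)) →
        IsVirtuallyNilpotentMax (derivedSeries G i)) := by
    rintro i ⟨s, hs⟩
    have hle : derivedSeries G (i + 1) ≤ derivedSeries G i :=
      derivedSeries_antitone G (Nat.le_succ i)
    obtain ⟨h1, h2⟩ := abelian_extension hG (derivedSeries G i) s (derivedSeries G (i + 1))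
      le_rfl (by rw [hs, sup_eq_right.2 hle])
    exact ⟨h1 ⟨s, hs⟩, h2⟩
  have hfgi : ∀ i, (derivedSeries G i).FG := by
    intro i
    induction i with
    | zero => exact Group.fg_def.1 hfg
    | succ i ih => exact (hstep i ih).1
  obtain ⟨n, hn⟩ := hsolv.solvable
  have hbot : IsVirtuallyNilpotentMax (derivedSeries G n) := by
    rw [hn]
    refine ⟨fun L hL => ?_, Group.IsNilpotent.isVirtuallyNilpotent inferInstance⟩
    rw [le_bot_iff.1 hL]
    exact ⟨∅, by simp⟩
  have hdown : ∀ j ≤ n, IsVirtuallyNilpotentMax (derivedSeries G (n - j)) := by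
    intro j hj
    induction j with
    | zero => exact hbot
    | succ j ih =>
      refine (hstep _ (hfgi _)).2 ?_
      rw [show n - (j + 1) + 1 = n - j by omega]
      exact ih (by omega)
  have htop := hdown n le_rfl
  rw [Nat.sub_self] at htop
  exact htop.2.of_equiv Subgroup.topEquiv

end

section
variable {G : Type*} [Group G]

lemma ball_succ_subset (S : Set G) (n : ℕ) :
    ball S (n + 1) ⊆ ball S n ∪ Set.image2 (· * ·) S (ball S n) := by
  rintro _ ⟨_ | ⟨a, l⟩, hl, hn, rfl⟩
  · exact Or.inl ⟨[], by simp, by simp, rfl⟩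
  · refine Or.inr ⟨a, hl a (by simp), l.prod, ⟨l, fun x hx => hl x (by simp [hx]), ?_, rfl⟩, ?_⟩
    · simpa using hn
    · simp

lemma finite_ball (S : Finset G) (n : ℕ) : (ball (S : Set G) n).Finite := by
  induction n with
  | zero =>
    refine (Set.finite_singleton 1).subset ?_
    rintro _ ⟨l, -, hn, rfl⟩
    simp [List.length_eq_zero_iff.1 (Nat.le_zero.1 hn)]
  | succ n ih => exact (ih.union (S.finite_toSet.image2 _ ih)).subset (ball_succ_subset _ _)

lemma ball_mono (S : Set G) {m n : ℕ} (h : m ≤ n) : ball S m ⊆ ball S n := by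
  rintro _ ⟨l, hl, hn, rfl⟩
  exact ⟨l, hl, hn.trans h, rfl⟩

lemma growth_mono (S : Finset G) {m n : ℕ} (h : m ≤ n) :
    growth (S : Set G) m ≤ growth (S : Set G) n :=
  Set.ncard_le_ncard (ball_mono _ h) (finite_ball S n)

lemma one_mem_ball (S : Set G) (n : ℕ) : 1 ∈ ball S n := ⟨[], by simp, by simp, rfl⟩

lemma mul_mem_ball {S : Set G} {m n : ℕ} {g h : G} (hg : g ∈ ball S m) (hh : h ∈ ball S n) :
    g * h ∈ ball S (m + n) := by
  obtain ⟨l, hl, hn, rfl⟩ := hg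
  obtain ⟨l', hl', hn', rfl⟩ := hh
  refine ⟨l ++ l', fun x hx => ?_, ?_, by simp⟩
  · rcases List.mem_append.1 hx with h | h
    exacts [hl x h, hl' x h]
  · simpa using by omega

lemma IsSymmGen.exists_mem_ball {S : Finset G} (hS : IsSymmGen S) (g : G) :
    ∃ n, g ∈ ball (S : Set G) n := by
  have hg : g ∈ Subgroup.closure (S : Set G) := hS.2 ▸ Subgroup.mem_top g
  have hinv : ∀ n, ∀ h ∈ ball (S : Set G) n, h⁻¹ ∈ ball (S : Set G) n := by
    rintro n _ ⟨l, hl, hn, rfl⟩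
    refine ⟨(l.map (·⁻¹)).reverse, fun x hx => ?_, by simpa using hn, ?_⟩
    · simp only [List.mem_reverse, List.mem_map] at hx
      obtain ⟨y, hy, rfl⟩ := hx
      exact hS.1 y (hl y hy)
    · rw [List.prod_inv_reverse]
  induction hg using Subgroup.closure_induction with
  | mem g hg => exact ⟨1, [g], by simpa using hg, by simp, by simp⟩
  | one => exact ⟨0, one_mem_ball _ _⟩
  | mul g h _ _ ih ih' =>
    obtain ⟨m, hm⟩ := ih
    obtain ⟨n, hn⟩ := ih'
    exact ⟨m + n, mul_mem_ball hm hn⟩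
  | inv g _ ih =>
    obtain ⟨m, hm⟩ := ih
    exact ⟨m, hinv m g hm⟩

lemma binWord_mem_ball {S : Set G} {L : ℕ} {x y : G} (hxy : x * y ∈ ball S L)
    (hy : y ∈ ball S L) (l : List Bool) : binWord x y l ∈ ball S (l.length * L) := by
  induction l with
  | nil => exact one_mem_ball _ _
  | cons b l ih =>
    rw [binWord_cons, List.length_cons, Nat.succ_mul, add_comm]
    refine mul_mem_ball ?_ ih
    cases b
    · exact hy
    · exact hxy

lemma exists_two_pow_le_growth (hG : ¬ HasCollisions G) {S : Finset G} (hS : IsSymmGen S) :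
    ∃ L : ℕ, 0 < L ∧ ∀ n : ℕ, 2 ^ n ≤ growth (S : Set G) (n * L) := by
  unfold HasCollisions at hG
  push Not at hG
  obtain ⟨x, y, hxy⟩ := hG
  obtain ⟨m, hm⟩ := hS.exists_mem_ball (x * y)
  obtain ⟨k, hk⟩ := hS.exists_mem_ball y
  refine ⟨m + k + 1, by omega, fun n => ?_⟩
  let f : List.Vector Bool n → G := fun v => binWord x y v.toList
  have hf : Function.Injective f := by
    intro v w hvw
    by_contra hne
    exact hxy v.toList w.toList (by simp) (fun h => hne (List.Vector.toList_injective h)) hvw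
  have hcard : (Set.range f).ncard = 2 ^ n := by
    rw [← Set.image_univ, Set.ncard_image_of_injective _ hf, Set.ncard_univ,
      Nat.card_eq_fintype_card, card_vector, Fintype.card_bool]
  rw [← hcard]
  refine Set.ncard_le_ncard ?_ (finite_ball S _)
  rintro _ ⟨v, rfl⟩
  have := binWord_mem_ball (ball_mono (S : Set G) (by omega : m ≤ m + k + 1) hm)
    (ball_mono (S : Set G) (by omega : k ≤ m + k + 1) hk) v.toList
  rwa [List.Vector.toList_length] at this

lemma two_le_growth [Nontrivial G] {S : Finset G} (hS : IsSymmGen S) {n : ℕ} (hn : 1 ≤ n) :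
    2 ≤ growth (S : Set G) n := by
  obtain ⟨s, hs, hs1⟩ : ∃ s ∈ S, s ≠ 1 := by
    by_contra! h
    have : Subgroup.closure (S : Set G) ≤ ⊥ := (Subgroup.closure_le _).2 h
    rw [hS.2] at this
    exact bot_ne_top (top_le_iff.1 this)
  rw [← Set.ncard_pair hs1]
  refine Set.ncard_le_ncard ?_ (finite_ball S n)
  rintro g (hg | hg)
  · exact ⟨[s], by simpa using hs, by simpa using hn, by simp [hg]⟩
  · rw [Set.mem_singleton_iff.1 hg]
    exact one_mem_ball _ _

lemma exists_pow_le_growth [Nontrivial G] (hG : ¬ HasCollisions G) {S : Finset G}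
    (hS : IsSymmGen S) :
    ∃ c : ℝ, 1 < c ∧ ∀ n : ℕ, 1 ≤ n → c ^ n ≤ (growth (S : Set G) n : ℝ) := by
  obtain ⟨L, hL, h⟩ := exists_two_pow_le_growth hG hS
  have hc : ((2 : ℝ) ^ ((2 * L : ℕ) : ℝ)⁻¹) ^ (2 * L) = 2 :=
    Real.rpow_inv_natCast_pow (by norm_num) (by omega)
  have hc1 : 1 < (2 : ℝ) ^ ((2 * L : ℕ) : ℝ)⁻¹ := by
    apply Real.one_lt_rpow (by norm_num)
    positivity
  set c := (2 : ℝ) ^ ((2 * L : ℕ) : ℝ)⁻¹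
  refine ⟨c, hc1, fun n hn => ?_⟩
  rcases lt_or_ge n L with hnL | hnL
  · calc c ^ n ≤ c ^ (2 * L) := pow_le_pow_right₀ hc1.le (by omega)
      _ = ((2 : ℕ) : ℝ) := by rw [hc]; norm_num
      _ ≤ _ := Nat.cast_le.2 (two_le_growth hS hn)
  · have h1 : 1 ≤ n / L := (Nat.one_le_div_iff hL).2 hnL
    have h2 : n / L * L ≤ n := Nat.div_mul_le_self n L
    have h3 : n < (n / L + 1) * L := by
      rw [mul_comm]
      exact Nat.lt_mul_div_succ n hL
    calc c ^ n ≤ c ^ (2 * L * (n / L)) := pow_le_pow_right₀ hc1.le (by nlinarith)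
      _ = ((2 ^ (n / L) : ℕ) : ℝ) := by rw [pow_mul, hc]; norm_num
      _ ≤ _ := Nat.cast_le.2 ((h _).trans (growth_mono S h2))

end

/-- (Milnor–Wolf) A finitely generated solvable group with no nilpotent subgroup of
finite index has exponential growth: for any finite symmetric generating set `S` there
is `c > 1` with `γ_S(n) ≥ c^n` for all `n ≥ 1`. -/
theorem stmt11 {G : Type*} [Group G] (hfg : Group.FG G) (hsolv : IsSolvable G)
    (hnonilp : ¬ ∃ H : Subgroup G, Group.IsNilpotent H ∧ H.FiniteIndex) :
    ∀ S : Finset G, IsSymmGen S →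
      ∃ c : ℝ, 1 < c ∧ ∀ n : ℕ, 1 ≤ n → c ^ n ≤ (growth (S : Set G) n : ℝ) := by
  intro S hS
  have hnt : Nontrivial G := by
    by_contra h
    rw [not_nontrivial_iff_subsingleton] at h
    exact hnonilp ⟨⊤, inferInstance, inferInstance⟩
  exact exists_pow_le_growth
    (fun hG => hnonilp (isVirtuallyNilpotent_of_hasCollisions hG hfg hsolv)) hS
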